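/- Let G be a finite simple graph with girth at least g. Then the power sums of the chromatic roots satisfy p_i(G) = |E(G)| for i = 1, 2, ..., g-2. -/

import Mathlib

open Polynomial

/-- The number of proper colorings of `G` with `q` colors. -/
noncomputable def properColorings {V : Type*} (G : SimpleGraph V) (q : ℕ) : ℕ :=
  Nat.card {f : V → Fin q // ∀ ⦃x y⦄, G.Adj x y → f x ≠ f y}

theorem cps_newton (s : Multiset ℂ) (k : ℕ) (h : 0 < k) :
    (s.map (· ^ k)).sum = (-1) ^ (k + 1) * k * s.esymm k -
    ∑ a ∈ Finset.HasAntidiagonal.antidiagonal k with a.1 ∈ Set.Ioo 0 k,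
      (-1) ^ a.fst * s.esymm a.1 * (s.map (· ^ a.2)).sum := by
  obtain ⟨l, rfl⟩ := Quot.exists_rep s
  have key : (Finset.univ.val.map (fun i : Fin l.length => l.get i)) = (l : Multiset ℂ) := by
    simp
  have h1 := congrArg (MvPolynomial.aeval (fun i : Fin l.length => l.get i))
    (MvPolynomial.psum_eq_mul_esymm_sub_sum (Fin l.length) ℂ k h)
  have hp : ∀ j, MvPolynomial.aeval (fun i : Fin l.length => l.get i)
      (MvPolynomial.psum (Fin l.length) ℂ j) = ((l : Multiset ℂ).map (· ^ j)).sum := by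
    intro j
    rw [← key, Multiset.map_map]
    simp only [MvPolynomial.psum, map_sum, map_pow, MvPolynomial.aeval_X]
    rfl
  simp only [map_sub, map_mul, map_pow, map_neg, map_one, map_natCast, map_sum, hp,
    MvPolynomial.aeval_esymm_eq_multiset_esymm] at h1
  rw [key] at h1
  exact h1

theorem cps_psum_congr (s t : Multiset ℂ) (N : ℕ)
    (h : ∀ k, 1 ≤ k → k ≤ N → s.esymm k = t.esymm k) :
    ∀ k, 1 ≤ k → k ≤ N → (s.map (· ^ k)).sum = (t.map (· ^ k)).sum := by
  intro k
  induction k using Nat.strong_induction_on with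
  | _ k ih =>
    intro h1 h2
    rw [cps_newton s k h1, cps_newton t k h1, h k h1 h2]
    congr 1
    refine Finset.sum_congr rfl ?_
    rintro ⟨a, b⟩ hab
    simp only [Finset.mem_filter, Finset.HasAntidiagonal.mem_antidiagonal, Set.mem_Ioo] at hab
    dsimp only
    rw [h a (by omega) (by omega), ih b (by omega) (by omega) (by omega)]

theorem cps_esymm_replicate (m k : ℕ) :
    (Multiset.replicate m (1 : ℂ)).esymm k = (m.choose k : ℂ) := by
  rw [Multiset.esymm]
  have : ∀ u ∈ (Multiset.replicate m (1 : ℂ)).powersetCard k, u.prod = 1 := by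
    intro u hu
    rw [Multiset.mem_powersetCard] at hu
    apply Multiset.prod_eq_one
    intro x hx
    exact Multiset.eq_of_mem_replicate (Multiset.mem_of_le hu.1 hx)
  rw [Multiset.map_congr rfl this]
  simp

open SimpleGraph

theorem cps_reach {V : Type*} (S : Set (Sym2 V)) (u v x y : V)
    (h : (fromEdgeSet (insert s(u, v) S)).Reachable x y) :
    (fromEdgeSet S).Reachable x y ∨
     (((fromEdgeSet S).Reachable x u ∨ (fromEdgeSet S).Reachable x v) ∧
      ((fromEdgeSet S).Reachable y u ∨ (fromEdgeSet S).Reachable y v)) := by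
  obtain ⟨p⟩ := h
  induction p with
  | nil => exact Or.inl (Reachable.refl _)
  | @cons a b c hab p ih =>
    rw [fromEdgeSet_adj] at hab
    obtain ⟨h1, h2⟩ := hab
    rcases h1 with h1 | h1
    · have hu := Reachable.refl (G := fromEdgeSet S) u
      have hv := Reachable.refl (G := fromEdgeSet S) v
      rcases Sym2.eq_iff.1 h1 with ⟨rfl, rfl⟩ | ⟨rfl, rfl⟩ <;>
      rcases ih with h | h
      · exact Or.inr ⟨Or.inl hu, Or.inr h.symm⟩
      · exact Or.inr ⟨Or.inl hu, h.2⟩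
      · exact Or.inr ⟨Or.inr hv, Or.inl h.symm⟩
      · exact Or.inr ⟨Or.inr hv, h.2⟩
    · have hr : (fromEdgeSet S).Reachable a b := Adj.reachable ((fromEdgeSet_adj S).2 ⟨h1, h2⟩)
      rcases ih with h | ⟨h, h'⟩
      · exact Or.inl (hr.trans h)
      · exact Or.inr ⟨h.imp hr.trans hr.trans, h'⟩

theorem cps_comp_insert {V : Type*} [Finite V] (S : Set (Sym2 V)) (u v : V)
    (h : ¬ (fromEdgeSet S).Reachable u v) :
    Nat.card (fromEdgeSet S).ConnectedComponent =
      Nat.card (fromEdgeSet (insert s(u, v) S)).ConnectedComponent + 1 := by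
  classical
  have hle : fromEdgeSet S ≤ fromEdgeSet (insert s(u, v) S) :=
    fromEdgeSet_mono (Set.subset_insert _ _)
  have huv : u ≠ v := by rintro rfl; exact h (Reachable.refl _)
  have hadj : (fromEdgeSet (insert s(u, v) S)).Adj u v :=
    (fromEdgeSet_adj _).2 ⟨Set.mem_insert _ _, huv⟩
  let f : {C : (fromEdgeSet S).ConnectedComponent // C ≠ (fromEdgeSet S).connectedComponentMk v} →
      (fromEdgeSet (insert s(u, v) S)).ConnectedComponent :=
    fun C => C.1.map (Hom.ofLE hle)
  have hf : Function.Bijective f := by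
    constructor
    · rintro ⟨C, hC⟩ ⟨D, hD⟩ hCD
      induction C using ConnectedComponent.ind with | _ x =>
      induction D using ConnectedComponent.ind with | _ y =>
      simp only [ne_eq, ConnectedComponent.eq] at hC hD
      simp only [f, ConnectedComponent.map_mk, ConnectedComponent.eq] at hCD
      simp only [Subtype.mk.injEq, ConnectedComponent.eq]
      rcases cps_reach S u v x y hCD with h | ⟨h1, h2⟩
      · exact h
      · exact (h1.resolve_right hC).trans (h2.resolve_right hD).symm
    · intro C
      induction C using ConnectedComponent.ind with | _ x =>
      by_cases hx : (fromEdgeSet S).Reachable x v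
      · refine ⟨⟨(fromEdgeSet S).connectedComponentMk u, ?_⟩, ?_⟩
        · simpa only [ne_eq, ConnectedComponent.eq] using h
        · simp only [f, ConnectedComponent.map_mk, ConnectedComponent.eq]
          exact hadj.reachable.trans (hx.mono hle).symm
      · refine ⟨⟨(fromEdgeSet S).connectedComponentMk x, ?_⟩, ?_⟩
        · simpa only [ne_eq, ConnectedComponent.eq] using hx
        · simp only [f, ConnectedComponent.map_mk, ConnectedComponent.eq]
          exact Reachable.refl _
  rw [← Nat.card_eq_of_bijective f hf]
  have := Fintype.ofFinite (fromEdgeSet S).ConnectedComponent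
  rw [Nat.card_eq_fintype_card, Nat.card_eq_fintype_card]
  have := Fintype.card_subtype_compl (fun C => C = (fromEdgeSet S).connectedComponentMk v)
  have h0 : 0 < Fintype.card (fromEdgeSet S).ConnectedComponent :=
    Fintype.card_pos_iff.2 ⟨(fromEdgeSet S).connectedComponentMk v⟩
  simp only [Fintype.card_subtype_eq] at this
  simp only [ne_eq]
  omega

theorem cps_forest {V : Type*} [Finite V] (S : Finset (Sym2 V)) (hd : ∀ e ∈ S, ¬ e.IsDiag)
    (h : (fromEdgeSet (S : Set (Sym2 V))).IsAcyclic) :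
    S.card + Nat.card (fromEdgeSet (S : Set (Sym2 V))).ConnectedComponent = Nat.card V := by
  classical
  induction S using Finset.induction_on with
  | empty =>
    simp only [Finset.card_empty, zero_add, Finset.coe_empty, fromEdgeSet_empty]
    refine (Nat.card_eq_of_bijective (fun v => (⊥ : SimpleGraph V).connectedComponentMk v) ⟨?_, ?_⟩).symm
    · intro x y hxy
      simpa using hxy
    · intro C
      induction C using ConnectedComponent.ind with | _ x => exact ⟨x, rfl⟩
  | insert e S he ih =>
    induction e using Sym2.ind with | _ u v =>
    have huv : u ≠ v := by simpa using hd s(u, v) (by simp)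
    have hle : fromEdgeSet (S : Set (Sym2 V)) ≤ fromEdgeSet ((insert s(u, v) S : Finset _) : Set (Sym2 V)) :=
      fromEdgeSet_mono (by simp)
    have ih' := ih (fun e he => hd e (by simp [he])) (h.anti hle)
    have hnr : ¬ (fromEdgeSet (S : Set (Sym2 V))).Reachable u v := by
      have hb := isAcyclic_iff_forall_adj_isBridge.1 h (v := u) (w := v) (by simp [huv])
      rw [isBridge_iff] at hb
      intro hr
      refine hb (hr.mono ?_)
      intro a b hab
      rw [fromEdgeSet_adj] at hab
      rw [deleteEdges_adj, fromEdgeSet_adj]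
      refine ⟨⟨by simpa using Or.inr hab.1, hab.2⟩, fun hm => he ?_⟩
      rw [Set.mem_singleton_iff] at hm
      rw [← hm]
      exact hab.1
    have := cps_comp_insert (S : Set (Sym2 V)) u v hnr
    rw [Finset.card_insert_of_notMem he, Finset.coe_insert]
    omega

theorem cps_cyclic {V : Type*} [Finite V] (g : ℕ) (S : Finset (Sym2 V))
    (hg : (g : ℕ∞) ≤ (fromEdgeSet (S : Set (Sym2 V))).egirth)
    (h : ¬ (fromEdgeSet (S : Set (Sym2 V))).IsAcyclic) :
    g ≤ S.card ∧
    Nat.card (fromEdgeSet (S : Set (Sym2 V))).ConnectedComponent + g ≤ Nat.card V + 1 := by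
  classical
  have := Fintype.ofFinite V
  have := Fintype.ofFinite (fromEdgeSet (S : Set (Sym2 V))).ConnectedComponent
  simp only [IsAcyclic, not_forall, not_not] at h
  obtain ⟨a, w, hw⟩ := h
  have hlen : g ≤ w.length := by exact_mod_cast le_egirth.1 hg a w hw
  constructor
  · refine hlen.trans ?_
    rw [← Walk.length_edges, ← List.toFinset_card_of_nodup hw.edges_nodup]
    apply Finset.card_le_card
    intro e he
    have := w.edges_subset_edgeSet (List.mem_toFinset.1 he)
    simp at this
    exact this.1
  · have h1 : w.support.tail.toFinset.card = w.length := by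
      rw [List.toFinset_card_of_nodup hw.support_nodup]
      simp
    let C0 := (fromEdgeSet (S : Set (Sym2 V))).connectedComponentMk a
    have h2 : (Finset.univ.erase C0).card ≤ (w.support.tail.toFinsetᶜ).card := by
      apply Finset.card_le_card_of_injOn (fun C => Quot.out C)
      · intro C hC
        replace hC := Finset.ne_of_mem_erase hC
        simp only [Finset.mem_coe, Finset.mem_compl, List.mem_toFinset]
        intro hm
        apply hC
        have hr := (w.takeUntil _ (List.mem_of_mem_tail hm)).reachable
        have hq : (fromEdgeSet (S : Set (Sym2 V))).connectedComponentMk (Quot.out C) = C :=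
          Quot.out_eq C
        rw [← hq]
        exact ConnectedComponent.sound hr.symm
      · intro C _ D _ hCD
        rw [← Quot.out_eq C, ← Quot.out_eq D]
        exact congrArg _ hCD
    rw [Finset.card_erase_of_mem (Finset.mem_univ _), Finset.card_compl, h1] at h2
    rw [Finset.card_univ] at h2
    have h3 : w.length ≤ Fintype.card V := h1 ▸ Finset.card_le_univ _
    rw [Nat.card_eq_fintype_card, Nat.card_eq_fintype_card]
    omega

theorem cps_const {V : Type*} [Finite V] (S : Set (Sym2 V)) (q : ℕ) :
    Nat.card {f : V → Fin q // ∀ e ∈ S, (e.map f).IsDiag} =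
      q ^ Nat.card (fromEdgeSet S).ConnectedComponent := by
  have hr : ∀ f : V → Fin q, (∀ e ∈ S, (e.map f).IsDiag) → ∀ x y,
      (fromEdgeSet S).Reachable x y → f x = f y := by
    rintro f hf x y ⟨p⟩
    induction p with
    | nil => rfl
    | @cons a b c hab p ih =>
      rw [← ih]
      simpa using hf _ ((fromEdgeSet_adj S).1 hab).1
  let F : {f : V → Fin q // ∀ e ∈ S, (e.map f).IsDiag} →
      ((fromEdgeSet S).ConnectedComponent → Fin q) :=
    fun f => Quot.lift f.1 (hr f.1 f.2)
  have hF : Function.Bijective F := by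
    constructor
    · rintro ⟨f, hf⟩ ⟨f', hf'⟩ h
      ext x
      exact congrArg Fin.val (congrFun h ((fromEdgeSet S).connectedComponentMk x))
    · intro h
      refine ⟨⟨fun x => h ((fromEdgeSet S).connectedComponentMk x), ?_⟩, ?_⟩
      · intro e he
        induction e using Sym2.ind with | _ x y =>
        simp only [Sym2.map_mk, Sym2.mk_isDiag_iff]
        by_cases hxy : x = y
        · rw [hxy]
        · congr 1
          exact ConnectedComponent.sound (Adj.reachable ((fromEdgeSet_adj S).2 ⟨he, hxy⟩))
      · funext C
        induction C using ConnectedComponent.ind with | _ x => rfl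
  rw [Nat.card_eq_of_bijective F hF]
  simp [Nat.card_fun]

theorem cps_whitney {V : Type*} [Fintype V] (G : SimpleGraph V) [Fintype G.edgeSet] (q : ℕ) :
    (properColorings G q : ℂ) = ∑ S ∈ G.edgeFinset.powerset,
      (-1) ^ S.card * (q : ℂ) ^ Nat.card (fromEdgeSet (S : Set (Sym2 V))).ConnectedComponent := by
  classical
  have h1 : (properColorings G q : ℂ) =
      ∑ f : V → Fin q, ∏ e ∈ G.edgeFinset, ((1 : ℂ) - if (e.map f).IsDiag then 1 else 0) := by
    rw [properColorings, Nat.card_eq_fintype_card, Fintype.card_subtype, Finset.card_filter]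
    push_cast
    refine Finset.sum_congr rfl fun f _ => ?_
    split_ifs with h
    · symm
      apply Finset.prod_eq_one
      intro e he
      induction e using Sym2.ind with | _ x y =>
      have := h (by simpa using he : G.Adj x y)
      simp [this]
    · push Not at h
      obtain ⟨x, y, hxy, hf⟩ := h
      symm
      apply Finset.prod_eq_zero (i := s(x, y)) (by simpa using hxy)
      simp [hf]
  rw [h1]
  simp_rw [Finset.prod_sub]
  rw [Finset.sum_comm]
  refine Finset.sum_congr rfl fun S hS => ?_
  have h2 := cps_const (S : Set (Sym2 V)) q
  rw [Nat.card_eq_fintype_card, Fintype.card_subtype, Finset.card_filter] at h2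
  have h3 := congrArg (Nat.cast : ℕ → ℂ) h2
  push_cast at h3
  rw [← h3, Finset.mul_sum]
  refine Finset.sum_congr rfl fun f _ => ?_
  simp only [Finset.prod_const_one, mul_one]
  congr 1
  rw [Finset.prod_ite_zero]
  simp

/-- If `G` has girth at least `g`, then the power sums of its chromatic roots satisfy
`p_i(G) = |E(G)|` for `i = 1, 2, …, g-2`. -/
theorem chromatic_power_sums_of_girth {V : Type*} [Fintype V]
    (G : SimpleGraph V) (g : ℕ) (hG : (g : ℕ∞) ≤ G.egirth)
    (P : Polynomial ℂ)
    (hP : ∀ q : ℕ, P.eval (q : ℂ) = properColorings G q)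
    (i : ℕ) (hi1 : 1 ≤ i) (hi2 : i ≤ g - 2) :
    (P.roots.map (· ^ i)).sum = (Nat.card G.edgeSet : ℂ) := by
  classical
  let c : Finset (Sym2 V) → ℕ := fun S =>
    Nat.card (fromEdgeSet (S : Set (Sym2 V))).ConnectedComponent
  set n := Nat.card V with hn
  set m := G.edgeFinset.card with hm
  have hPQ : P = ∑ S ∈ G.edgeFinset.powerset, C ((-1 : ℂ) ^ S.card) * X ^ c S := by
    apply Polynomial.eq_of_infinite_eval_eq
    refine Set.Infinite.mono ?_ (Set.infinite_range_of_injective (Nat.cast_injective (R := ℂ)))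
    rintro _ ⟨q, rfl⟩
    change P.eval (q : ℂ) = _
    rw [hP, cps_whitney, eval_finsetSum]
    refine Finset.sum_congr rfl fun S _ => ?_
    simp [c]
  have hdich : ∀ S ∈ G.edgeFinset.powerset, S.card + c S = n ∨ (g ≤ S.card ∧ c S + g ≤ n + 1) := by
    intro S hS
    rw [Finset.mem_powerset] at hS
    have hS' : (S : Set (Sym2 V)) ⊆ G.edgeSet := fun e he => by simpa using hS he
    by_cases h : (fromEdgeSet (S : Set (Sym2 V))).IsAcyclic
    · exact Or.inl (cps_forest S (fun e he => G.not_isDiag_of_mem_edgeSet (hS' he)) h)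
    · refine Or.inr (cps_cyclic g S (hG.trans (egirth_anti ?_)) h)
      calc _ ≤ fromEdgeSet G.edgeSet := fromEdgeSet_mono hS'
        _ = G := fromEdgeSet_edgeSet G
  have hcoeff : ∀ k ≤ g - 2, k ≤ n → P.coeff (n - k) = (-1) ^ k * (m.choose k : ℂ) := by
    intro k hk hkn
    rw [hPQ, finsetSum_coeff]
    simp only [coeff_C_mul_X_pow]
    rw [← Finset.sum_filter]
    have : (G.edgeFinset.powerset.filter fun S => n - k = c S) = G.edgeFinset.powersetCard k := by
      ext S
      rw [Finset.mem_filter, Finset.mem_powersetCard, Finset.mem_powerset]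
      refine and_congr_right fun hS => ?_
      have := hdich S (Finset.mem_powerset.2 hS)
      omega
    rw [this, Finset.sum_congr rfl (g := fun _ => (-1 : ℂ) ^ k)
      (fun S hS => by rw [(Finset.mem_powersetCard.1 hS).2])]
    simp [mul_comm, hm]
  have hdeg : P.natDegree ≤ n := by
    rw [hPQ]
    refine natDegree_sum_le_of_forall_le _ _ fun S hS => ?_
    refine (natDegree_C_mul_X_pow_le _ _).trans ?_
    have := hdich S hS
    omega
  have hlead : P.coeff n = 1 := by simpa using hcoeff 0 (by omega) (by omega)
  have hdeg' : P.natDegree = n := le_antisymm hdeg (le_natDegree_of_ne_zero (by simp [hlead]))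
  have hsplit := IsAlgClosed.splits P
  have hcard : P.roots.card = n := by rw [splits_iff_card_roots.1 hsplit, hdeg']
  have hes : ∀ k, 1 ≤ k → k ≤ g - 2 →
      P.roots.esymm k = (Multiset.replicate m (1 : ℂ)).esymm k := by
    intro k hk1 hk
    rw [cps_esymm_replicate]
    by_cases hkn : k ≤ n
    · have h1 := hcoeff k hk hkn
      rw [coeff_eq_esymm_roots_of_splits hsplit (by omega), leadingCoeff, hdeg', hlead, one_mul,
        Nat.sub_sub_self hkn] at h1
      exact mul_left_cancel₀ (pow_ne_zero _ (by norm_num)) h1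
    · rw [Multiset.esymm, Multiset.powersetCard_eq_empty _ (by omega), Nat.choose_eq_zero_of_lt]
      · simp
      · by_contra hlt
        obtain ⟨S, hS, hSk⟩ := Finset.exists_subset_card_eq (not_lt.1 hlt)
        have := hdich S (Finset.mem_powerset.2 hS)
        omega
  rw [cps_psum_congr _ _ (g - 2) hes i hi1 hi2]
  rw [Nat.card_eq_fintype_card, ← edgeFinset_card]
  simp [hm]
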